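/- Let θ ∈ ℝ^d be a point at which the training loss f of the non-linear fully connected network coincides, on an open set containing θ, with the fixed-activation-pattern function θ ↦ (1/|S|) Σ_i ℓ((D'_{i,*}W_*)_{n:1} x_i, y_i). Then λ_min(∇²f(θ)) ≥ −max{|α|, |ᾱ|}^{n−1} · ((n−1)/|S|) · Σ_{i=1}^{|S|} ‖∇ℓ_i‖₂·‖x_i‖₂ · max_{J⊆{1,…,n}, |J| = n−2} ∏_{j∈J} ‖W_j‖_F, where an empty product equals one. -/

import Mathlib

open scoped RealInnerProductSpace
open Matrix

noncomputable section

/-- The family of weight matrices of a depth-`n` fully connected network with layer widths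
`dims 0, dims 1, …, dims n`: `W j` maps `ℝ^{dims j}` to `ℝ^{dims (j+1)}` (zero-indexed). -/
abbrev WeightFam (n : ℕ) (dims : ℕ → ℕ) : Type :=
  ∀ j : Fin n, Matrix (Fin (dims (j.val + 1))) (Fin (dims j.val)) ℝ

/-- Rectangular matrix with ones on the diagonal: equals the identity matrix whenever the
two dimensions coincide. -/
def castId (p q : ℕ) : Matrix (Fin p) (Fin q) ℝ :=
  Matrix.of fun i j => if (i : ℕ) = (j : ℕ) then 1 else 0

/-- Multiplication of a Euclidean vector by a matrix. -/
def mulVecE {p q : ℕ} (M : Matrix (Fin p) (Fin q) ℝ) (v : EuclideanSpace ℝ (Fin q)) :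
    EuclideanSpace ℝ (Fin p) :=
  (EuclideanSpace.equiv (Fin p) ℝ).symm (M.mulVec (EuclideanSpace.equiv (Fin q) ℝ v))

/-- The homogeneous activation `σ(z) = α·max{z,0} - α'·max{-z,0}`. -/
def actFn (α α' : ℝ) (z : ℝ) : ℝ := α * max z 0 - α' * max (-z) 0

/-- Entrywise application of the activation. -/
def actVec (α α' : ℝ) {p : ℕ} (v : EuclideanSpace ℝ (Fin p)) : EuclideanSpace ℝ (Fin p) :=
  (EuclideanSpace.equiv (Fin p) ℝ).symm fun i => actFn α α' (v i)

/-- Forward pass of the network: the output of layer `k` on input `x`, the activation being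
applied after every layer except the last one. -/
def layerOut {n : ℕ} (α α' : ℝ) (dims : ℕ → ℕ) (W : WeightFam n dims)
    (x : EuclideanSpace ℝ (Fin (dims 0))) : (k : ℕ) → EuclideanSpace ℝ (Fin (dims k))
  | 0 => x
  | k + 1 =>
      if hk : k < n then
        if k + 1 = n then mulVecE (W ⟨k, hk⟩) (layerOut α α' dims W x k)
        else actVec α α' (mulVecE (W ⟨k, hk⟩) (layerOut α α' dims W x k))
      else 0

/-- The training loss of the fully connected neural network with activation `σ`:
`f(θ) = (1/|S|) ∑ᵢ ℓ(h_θ(xᵢ), yᵢ)`. -/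
def netLossNL {Y : Type*} {s : ℕ} {n d : ℕ} (dims : ℕ → ℕ) (α α' : ℝ)
    (loss : EuclideanSpace ℝ (Fin (dims n)) → Y → ℝ)
    (x : Fin s → EuclideanSpace ℝ (Fin (dims 0))) (y : Fin s → Y)
    (arr : EuclideanSpace ℝ (Fin d) →ₗ[ℝ] WeightFam n dims)
    (θ : EuclideanSpace ℝ (Fin d)) : ℝ :=
  (1 / (s : ℝ)) * ∑ i, loss (layerOut α α' dims (arr θ) (x i) n) (y i)

/-- `segProdD dims W D a b = (D_b W_{b-1}) · (D_{b-1} W_{b-2}) ⋯ (D_{a+1} W_a)`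
(zero-indexed weight matrices, `D k` being the diagonal entries of the activation-pattern
matrix at level `k`): the paper's fixed-pattern product `(D'_{i,*} W_*)_{b : a+1}`
(one-indexed), empty products being identity matrices. -/
def segProdD {n : ℕ} (dims : ℕ → ℕ) (W : WeightFam n dims)
    (D : (j : ℕ) → Fin (dims j) → ℝ) (a : ℕ) :
    (b : ℕ) → Matrix (Fin (dims b)) (Fin (dims a)) ℝ
  | 0 => castId (dims 0) (dims a)
  | b + 1 =>
      if a = b + 1 then castId (dims (b + 1)) (dims a)
      else if hb : b < n then
        Matrix.diagonal (D (b + 1)) * W ⟨b, hb⟩ * segProdD dims W D a b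
      else 0

/-- The fixed-activation-pattern loss
`θ ↦ (1/|S|) ∑ᵢ ℓ((D'_{i,*}W_*)_{n:1} xᵢ, yᵢ)`. -/
def patLoss {Y : Type*} {s : ℕ} {n d : ℕ} (dims : ℕ → ℕ)
    (loss : EuclideanSpace ℝ (Fin (dims n)) → Y → ℝ)
    (x : Fin s → EuclideanSpace ℝ (Fin (dims 0))) (y : Fin s → Y)
    (D : Fin s → (j : ℕ) → Fin (dims j) → ℝ)
    (arr : EuclideanSpace ℝ (Fin d) →ₗ[ℝ] WeightFam n dims)
    (θ : EuclideanSpace ℝ (Fin d)) : ℝ :=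
  (1 / (s : ℝ)) * ∑ i, loss (mulVecE (segProdD dims (arr θ) (D i) 0 n) (x i)) (y i)

/-- The Hessian of `f` at `x`, regarded as a quadratic form, evaluated at `v`. -/
def hessQ {E : Type*} [NormedAddCommGroup E] [InnerProductSpace ℝ E] [CompleteSpace E]
    (f : E → ℝ) (x v : E) : ℝ :=
  ⟪v, fderiv ℝ (gradient f) x v⟫

/-- Frobenius norm of a matrix. -/
def frobNorm {p q : ℕ} (M : Matrix (Fin p) (Fin q) ℝ) : ℝ :=
  Real.sqrt (∑ i, ∑ j, M i j ^ 2)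

section SecondOrder

/-- Second-order necessary condition at a local minimum of a function of one real variable. -/
lemma IsLocalMin.nonneg_of_hasDerivAt_hasDerivAt {g g' : ℝ → ℝ} {a c : ℝ}
    (hmin : IsLocalMin g a) (hg : ∀ t, HasDerivAt g (g' t) t) (hg' : HasDerivAt g' c a) :
    0 ≤ c := by
  by_contra! hc
  have hderiv : deriv g = g' := funext fun t => (hg t).deriv
  have hmax : IsLocalMax g a := by
    refine isLocalMax_of_deriv_deriv_neg ?_ ?_ (hg a).continuousAt
    · rwa [hderiv, hg'.deriv]
    · exact hmin.deriv_eq_zero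
  have hconst : g =ᶠ[nhds a] fun _ => g a := by
    filter_upwards [hmin, hmax] with t h₁ h₂ using le_antisymm h₂ h₁
  have hzero : g' =ᶠ[nhds a] fun _ => 0 := by
    rw [← hderiv]
    filter_upwards [hconst.deriv] with t ht
    simpa using ht
  have := hg'.unique ((hasDerivAt_const a (0 : ℝ)).congr_of_eventuallyEq hzero)
  exact hc.ne this

/-- A differentiable convex function lies above its tangent hyperplanes. -/
lemma ConvexOn.add_inner_gradient_le {E : Type*} [NormedAddCommGroup E] [InnerProductSpace ℝ E]
    [CompleteSpace E] {f : E → ℝ} (hf : ConvexOn ℝ Set.univ f) {p : E}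
    (hd : DifferentiableAt ℝ f p) (q : E) :
    f p + ⟪gradient f p, q - p⟫ ≤ f q := by
  have hline : ConvexOn ℝ Set.univ (f ∘ AffineMap.lineMap (k := ℝ) p q) := by
    simpa using hf.comp_affineMap (AffineMap.lineMap (k := ℝ) p q)
  have hder : HasDerivAt (f ∘ AffineMap.lineMap (k := ℝ) p q) ⟪gradient f p, q - p⟫ (0 : ℝ) := by
    have h₁ : HasDerivAt (fun t : ℝ => AffineMap.lineMap (k := ℝ) p q t) (q - p) 0 :=
      AffineMap.hasDerivAt_lineMap
    have h₂ : HasFDerivAt f (fderiv ℝ f p) (AffineMap.lineMap (k := ℝ) p q (0 : ℝ)) := by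
      simpa using hd.hasFDerivAt
    have h₃ := h₂.comp_hasDerivAt (0 : ℝ) h₁
    rwa [← toDual_gradient, InnerProductSpace.toDual_apply_apply] at h₃
  have := hline.le_slope_of_hasDerivAt (Set.mem_univ 0) (Set.mem_univ 1) zero_lt_one hder
  simp only [slope_def_field, Function.comp_apply, AffineMap.lineMap_apply_zero,
    AffineMap.lineMap_apply_one, sub_zero, div_one] at this
  linarith

variable {E : Type*} [NormedAddCommGroup E] [InnerProductSpace ℝ E] [CompleteSpace E]

lemma ContDiff.differentiable_gradient {f : E → ℝ} (hf : ContDiff ℝ 2 f) :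
    Differentiable ℝ (gradient f) := by
  have h : Differentiable ℝ (fderiv ℝ f) :=
    (hf.fderiv_right (m := 1) (by norm_num)).differentiable (by norm_num)
  exact (InnerProductSpace.toDual ℝ E).symm.toContinuousLinearEquiv.differentiable.comp h

omit [CompleteSpace E] in
lemma hasDerivAt_line (x v : E) (t : ℝ) : HasDerivAt (fun t : ℝ => x + t • v) v t := by
  simpa using ((hasDerivAt_id t).smul_const v).const_add x

lemma ContDiff.hasDerivAt_comp_line {f : E → ℝ} (hf : ContDiff ℝ 2 f) (x v : E) (t : ℝ) :
    HasDerivAt (fun t : ℝ => f (x + t • v)) ⟪v, gradient f (x + t • v)⟫ t := by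
  have h := (hf.differentiable (by norm_num) (x + t • v)).hasFDerivAt.comp_hasDerivAt t
    (hasDerivAt_line x v t)
  rw [← toDual_gradient, InnerProductSpace.toDual_apply_apply, real_inner_comm] at h
  exact h

lemma ContDiff.hasDerivAt_inner_gradient_comp_line {f : E → ℝ} (hf : ContDiff ℝ 2 f) (x v : E) :
    HasDerivAt (fun t : ℝ => ⟪v, gradient f (x + t • v)⟫) (hessQ f x v) 0 := by
  have h₁ : HasFDerivAt (gradient f) (fderiv ℝ (gradient f) x) (x + (0 : ℝ) • v) := by
    simpa using (hf.differentiable_gradient x).hasFDerivAt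
  have h := (h₁.comp_hasDerivAt (0 : ℝ) (hasDerivAt_line x v 0))
  simpa [hessQ] using (hasDerivAt_const (0 : ℝ) v).inner ℝ h

lemma Filter.EventuallyEq.hessQ_eq {f g : E → ℝ} {x : E} (h : f =ᶠ[nhds x] g) (v : E) :
    hessQ f x v = hessQ g x v := by
  rw [hessQ, hessQ, h.gradient.fderiv_eq]

end SecondOrder

section MixedProducts

open Finset

/-- The sum, over the indices `a < k`, of the products in which the factor `w a` of
`∏ j < k, w j` is replaced by `v a`. -/
def replaceOne (w v : ℕ → ℝ) (k : ℕ) : ℝ :=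
  ∑ a ∈ range k, v a * ∏ j ∈ (range k).erase a, w j

/-- The sum, over the pairs of indices `a < b < k`, of the products in which the factors
`w a`, `w b` of `∏ j < k, w j` are replaced by `v a`, `v b`. -/
def replaceTwo (w v : ℕ → ℝ) (k : ℕ) : ℝ :=
  ∑ b ∈ range k, ∑ a ∈ range b, v a * v b * ∏ j ∈ ((range k).erase b).erase a, w j

lemma replaceOne_succ (w v : ℕ → ℝ) (k : ℕ) :
    replaceOne w v (k + 1) = w k * replaceOne w v k + v k * ∏ j ∈ range k, w j := by
  rw [replaceOne, sum_range_succ, replaceOne, mul_sum]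
  congr 1
  · refine sum_congr rfl fun a ha => ?_
    have hak : k ≠ a := by simp at ha; omega
    rw [range_add_one, erase_insert_of_ne hak, prod_insert (by simp)]
    ring
  · rw [range_add_one, erase_insert (by simp)]

lemma replaceTwo_succ (w v : ℕ → ℝ) (k : ℕ) :
    replaceTwo w v (k + 1) = w k * replaceTwo w v k + v k * replaceOne w v k := by
  rw [replaceTwo, sum_range_succ, replaceTwo, replaceOne, mul_sum, mul_sum]
  congr 1
  · refine sum_congr rfl fun b hb => ?_
    rw [mul_sum]
    refine sum_congr rfl fun a ha => ?_
    simp only [mem_range] at ha hb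
    rw [range_add_one, erase_insert_of_ne (by omega), erase_insert_of_ne (by omega),
      prod_insert (by simp)]
    ring
  · refine sum_congr rfl fun a _ => ?_
    rw [range_add_one, erase_insert (by simp)]
    ring

lemma two_mul_sum_pairs (v : ℕ → ℝ) (k : ℕ) :
    2 * ∑ b ∈ range k, ∑ a ∈ range b, v a * v b =
      (∑ a ∈ range k, v a) ^ 2 - ∑ a ∈ range k, v a ^ 2 := by
  induction k with
  | zero => simp
  | succ k ih =>
    rw [sum_range_succ, mul_add, ih, sum_range_succ, sum_range_succ, ← sum_mul]
    ring

lemma two_mul_replaceTwo_le {w v : ℕ → ℝ} (hv : ∀ k, 0 ≤ v k) {n : ℕ} {M : ℝ} (hM₀ : 0 ≤ M)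
    (hM : ∀ J ⊆ range n, J.card = n - 2 → ∏ j ∈ J, w j ≤ M) :
    2 * replaceTwo w v n ≤ M * ((n - 1) * ∑ a ∈ range n, v a ^ 2) := by
  have h₁ : replaceTwo w v n ≤ ∑ b ∈ range n, ∑ a ∈ range b, v a * v b * M := by
    refine sum_le_sum fun b hb => sum_le_sum fun a ha => ?_
    simp only [mem_range] at ha hb
    refine mul_le_mul_of_nonneg_left (hM _ ?_ ?_) (mul_nonneg (hv a) (hv b))
    · exact (erase_subset _ _).trans (erase_subset _ _)
    · rw [card_erase_of_mem, card_erase_of_mem, card_range]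
      · omega
      · simpa using hb
      · simp only [mem_erase, mem_range]; omega
  have h₀ : ∑ b ∈ range n, ∑ a ∈ range b, v a * v b * M =
      M * ∑ b ∈ range n, ∑ a ∈ range b, v a * v b := by
    simp only [mul_sum, mul_comm]
  rw [h₀] at h₁
  have h₂ := two_mul_sum_pairs v n
  have h₃ := sq_sum_le_card_mul_sum_sq (s := range n) (f := v)
  rw [card_range] at h₃
  have h₄ : 2 * ∑ b ∈ range n, ∑ a ∈ range b, v a * v b ≤ (n - 1) * ∑ a ∈ range n, v a ^ 2 := by
    linarith
  calc 2 * replaceTwo w v n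
      ≤ M * (2 * ∑ b ∈ range n, ∑ a ∈ range b, v a * v b) := by linarith
    _ ≤ _ := mul_le_mul_of_nonneg_left h₄ hM₀

end MixedProducts

section LayerComposition

variable {X : Type*} [NormedAddCommGroup X] [NormedSpace ℝ X]
  {E : ℕ → Type*} [∀ k, NormedAddCommGroup (E k)] [∀ k, NormedSpace ℝ (E k)]

/-- The state after `k` layers, the `k`-th of which acts by a linear map that depends linearly
on the parameter `θ`. -/
def layerState (Λ : ∀ k, X →L[ℝ] E k →L[ℝ] E (k + 1)) (x : E 0) (θ : X) : ∀ k, E k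
  | 0 => x
  | k + 1 => Λ k θ (layerState Λ x θ k)

/-- The derivative of `layerState` in the direction `v`. -/
def layerDeriv (Λ : ∀ k, X →L[ℝ] E k →L[ℝ] E (k + 1)) (x : E 0) (v θ : X) : ∀ k, E k
  | 0 => 0
  | k + 1 => Λ k θ (layerDeriv Λ x v θ k) + Λ k v (layerState Λ x θ k)

/-- The second derivative of `layerState` in the direction `v`. -/
def layerDeriv₂ (Λ : ∀ k, X →L[ℝ] E k →L[ℝ] E (k + 1)) (x : E 0) (v θ : X) : ∀ k, E k
  | 0 => 0
  | k + 1 => Λ k θ (layerDeriv₂ Λ x v θ k) + (2 : ℝ) • Λ k v (layerDeriv Λ x v θ k)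

variable (Λ : ∀ k, X →L[ℝ] E k →L[ℝ] E (k + 1)) (x : E 0)

lemma contDiff_layerState {m : WithTop ℕ∞} (k : ℕ) :
    ContDiff ℝ m fun θ => layerState Λ x θ k := by
  induction k with
  | zero => exact contDiff_const
  | succ k ih => exact (Λ k).contDiff.clm_apply ih

lemma hasDerivAt_layerMap_comp_line (θ v : X) (k : ℕ) (t : ℝ) :
    HasDerivAt (fun t : ℝ => Λ k (θ + t • v)) (Λ k v) t := by
  have h : HasDerivAt (fun t : ℝ => θ + t • v) v t := by
    simpa using ((hasDerivAt_id t).smul_const v).const_add θ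
  exact (Λ k).hasFDerivAt.comp_hasDerivAt t h

lemma hasDerivAt_layerState (θ v : X) (k : ℕ) (t : ℝ) :
    HasDerivAt (fun t : ℝ => layerState Λ x (θ + t • v) k)
      (layerDeriv Λ x v (θ + t • v) k) t := by
  induction k with
  | zero => exact hasDerivAt_const t x
  | succ k ih =>
    have h := (hasDerivAt_layerMap_comp_line Λ θ v k t).clm_apply ih
    exact h.congr_deriv (add_comm _ _)

lemma hasDerivAt_layerDeriv (θ v : X) (k : ℕ) (t : ℝ) :
    HasDerivAt (fun t : ℝ => layerDeriv Λ x v (θ + t • v) k)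
      (layerDeriv₂ Λ x v (θ + t • v) k) t := by
  induction k with
  | zero => exact hasDerivAt_const t 0
  | succ k ih =>
    have h₁ := (hasDerivAt_layerMap_comp_line Λ θ v k t).clm_apply ih
    have h₂ := (Λ k v).hasFDerivAt.comp_hasDerivAt t (hasDerivAt_layerState Λ x θ v k t)
    refine (h₁.add h₂).congr_deriv ?_
    rw [layerDeriv₂, two_smul]
    abel

section Bounds

variable {Λ x} {θ v : X} {δ w u : ℕ → ℝ} (hδ : ∀ k, 0 ≤ δ k) (hw : ∀ k, 0 ≤ w k)
  (hu : ∀ k, 0 ≤ u k) (hθ : ∀ k z, ‖Λ k θ z‖ ≤ δ k * (w k * ‖z‖))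
  (hv : ∀ k z, ‖Λ k v z‖ ≤ δ k * (u k * ‖z‖))

include hδ hw hθ in
lemma norm_layerState_le (k : ℕ) :
    ‖layerState Λ x θ k‖ ≤
      (∏ j ∈ Finset.range k, δ j) * (∏ j ∈ Finset.range k, w j) * ‖x‖ := by
  induction k with
  | zero => simp [layerState]
  | succ k ih =>
    calc ‖layerState Λ x θ (k + 1)‖ ≤ δ k * (w k * ‖layerState Λ x θ k‖) := hθ k _
      _ ≤ δ k * (w k *
          ((∏ j ∈ Finset.range k, δ j) * (∏ j ∈ Finset.range k, w j) * ‖x‖)) :=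
        mul_le_mul_of_nonneg_left (mul_le_mul_of_nonneg_left ih (hw k)) (hδ k)
      _ = _ := by rw [Finset.prod_range_succ, Finset.prod_range_succ]; ring

include hδ hw hu hθ hv in
lemma norm_layerDeriv_le (k : ℕ) :
    ‖layerDeriv Λ x v θ k‖ ≤
      (∏ j ∈ Finset.range k, δ j) * replaceOne w u k * ‖x‖ := by
  induction k with
  | zero => simp [layerDeriv, replaceOne]
  | succ k ih =>
    calc ‖layerDeriv Λ x v θ (k + 1)‖
        ≤ δ k * (w k * ‖layerDeriv Λ x v θ k‖) + δ k * (u k * ‖layerState Λ x θ k‖) :=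
        (norm_add_le _ _).trans (add_le_add (hθ k _) (hv k _))
      _ ≤ δ k * (w k * ((∏ j ∈ Finset.range k, δ j) * replaceOne w u k * ‖x‖)) +
          δ k * (u k *
            ((∏ j ∈ Finset.range k, δ j) * (∏ j ∈ Finset.range k, w j) * ‖x‖)) :=
        add_le_add
          (mul_le_mul_of_nonneg_left (mul_le_mul_of_nonneg_left ih (hw k)) (hδ k))
          (mul_le_mul_of_nonneg_left
            (mul_le_mul_of_nonneg_left (norm_layerState_le hδ hw hθ k) (hu k)) (hδ k))
      _ = _ := by rw [Finset.prod_range_succ, replaceOne_succ]; ring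

include hδ hw hu hθ hv in
lemma norm_layerDeriv₂_le (k : ℕ) :
    ‖layerDeriv₂ Λ x v θ k‖ ≤
      (∏ j ∈ Finset.range k, δ j) * (2 * replaceTwo w u k) * ‖x‖ := by
  induction k with
  | zero => simp [layerDeriv₂, replaceTwo]
  | succ k ih =>
    have h₂ : ‖(2 : ℝ) • Λ k v (layerDeriv Λ x v θ k)‖ ≤
        2 * (δ k * (u k * ‖layerDeriv Λ x v θ k‖)) := by
      rw [norm_smul, Real.norm_two]
      exact mul_le_mul_of_nonneg_left (hv k _) zero_le_two
    calc ‖layerDeriv₂ Λ x v θ (k + 1)‖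
        ≤ δ k * (w k * ‖layerDeriv₂ Λ x v θ k‖) +
          2 * (δ k * (u k * ‖layerDeriv Λ x v θ k‖)) :=
        (norm_add_le _ _).trans (add_le_add (hθ k _) h₂)
      _ ≤ δ k * (w k * ((∏ j ∈ Finset.range k, δ j) * (2 * replaceTwo w u k) * ‖x‖)) +
          2 * (δ k * (u k * ((∏ j ∈ Finset.range k, δ j) * replaceOne w u k * ‖x‖))) :=
        add_le_add
          (mul_le_mul_of_nonneg_left (mul_le_mul_of_nonneg_left ih (hw k)) (hδ k))
          (mul_le_mul_of_nonneg_left (mul_le_mul_of_nonneg_left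
            (mul_le_mul_of_nonneg_left (norm_layerDeriv_le hδ hw hu hθ hv k) (hu k)) (hδ k))
            zero_le_two)
      _ = _ := by rw [Finset.prod_range_succ, replaceTwo_succ]; ring

end Bounds

end LayerComposition

section ConvexSuperposition

variable {X F : Type*} [NormedAddCommGroup X] [InnerProductSpace ℝ X] [CompleteSpace X]
  [NormedAddCommGroup F] [InnerProductSpace ℝ F] [CompleteSpace F]

/-- If `φ i` are convex and `P i` are curves, then the Hessian form of an average of `φ i ∘ P i`
is bounded below by the contribution of the second derivatives of the curves. -/
lemma sum_inner_gradient_le_hessQ {s : ℕ} {φ : Fin s → F → ℝ} {P : Fin s → X → F}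
    (hφ : ∀ i, ConvexOn ℝ Set.univ (φ i)) (hφ₂ : ∀ i, ContDiff ℝ 2 (φ i))
    (hP : ∀ i, ContDiff ℝ 2 (P i)) (θ v : X) {P' : Fin s → ℝ → F} {P'' : Fin s → F}
    (hP' : ∀ i t, HasDerivAt (fun t : ℝ => P i (θ + t • v)) (P' i t) t)
    (hP'' : ∀ i, HasDerivAt (P' i) (P'' i) 0) :
    1 / (s : ℝ) * ∑ i, ⟪gradient (φ i) (P i θ), P'' i⟫ ≤
      hessQ (fun θ => 1 / (s : ℝ) * ∑ i, φ i (P i θ)) θ v := by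
  set f : X → ℝ := fun θ => 1 / (s : ℝ) * ∑ i, φ i (P i θ) with hf
  have hf₂ : ContDiff ℝ 2 f :=
    contDiff_const.mul (ContDiff.sum fun i _ => (hφ₂ i).comp (hP i))
  set ψ : ℝ → ℝ :=
    fun t => 1 / (s : ℝ) * ∑ i, ⟪gradient (φ i) (P i θ), P i (θ + t • v)⟫ with hψ
  set ψ' : ℝ → ℝ := fun t => 1 / (s : ℝ) * ∑ i, ⟪gradient (φ i) (P i θ), P' i t⟫
  have hψ₁ : ∀ t, HasDerivAt ψ (ψ' t) t := fun t => by
    refine HasDerivAt.const_mul _ (HasDerivAt.fun_sum fun i _ => ?_)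
    simpa using (hasDerivAt_const t (gradient (φ i) (P i θ))).inner ℝ (hP' i t)
  have hψ₂ : HasDerivAt ψ' (1 / (s : ℝ) * ∑ i, ⟪gradient (φ i) (P i θ), P'' i⟫) 0 := by
    refine HasDerivAt.const_mul _ (HasDerivAt.fun_sum fun i _ => ?_)
    simpa using (hasDerivAt_const (0 : ℝ) (gradient (φ i) (P i θ))).inner ℝ (hP'' i)
  have hmin : IsLocalMin (fun t : ℝ => f (θ + t • v) - ψ t) 0 := by
    refine Filter.Eventually.of_forall fun t => ?_
    simp only [hf, hψ, ← mul_sub, ← Finset.sum_sub_distrib]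
    refine mul_le_mul_of_nonneg_left (Finset.sum_le_sum fun i _ => ?_) (by positivity)
    have := (hφ i).add_inner_gradient_le ((hφ₂ i).differentiable (by norm_num) (P i θ))
      (P i (θ + t • v))
    rw [inner_sub_right] at this
    simp only [zero_smul, add_zero]
    linarith
  have := hmin.nonneg_of_hasDerivAt_hasDerivAt
    (fun t => (hf₂.hasDerivAt_comp_line θ v t).sub (hψ₁ t))
    ((hf₂.hasDerivAt_inner_gradient_comp_line θ v).sub hψ₂)
  linarith

end ConvexSuperposition

section Network

lemma frobNorm_nonneg {p q : ℕ} (M : Matrix (Fin p) (Fin q) ℝ) : 0 ≤ frobNorm M :=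
  Real.sqrt_nonneg _

lemma frobNorm_sq {p q : ℕ} (M : Matrix (Fin p) (Fin q) ℝ) :
    frobNorm M ^ 2 = ∑ i, ∑ j, M i j ^ 2 :=
  Real.sq_sqrt (Finset.sum_nonneg fun _ _ => Finset.sum_nonneg fun _ _ => sq_nonneg _)

lemma mulVecE_apply {p q : ℕ} (M : Matrix (Fin p) (Fin q) ℝ) (z : EuclideanSpace ℝ (Fin q))
    (i : Fin p) : mulVecE M z i = ∑ j, M i j * z j := rfl

lemma mulVecE_mul {p q r : ℕ} (M : Matrix (Fin p) (Fin q) ℝ) (N : Matrix (Fin q) (Fin r) ℝ)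
    (z : EuclideanSpace ℝ (Fin r)) : mulVecE (M * N) z = mulVecE M (mulVecE N z) := by
  exact congrArg (WithLp.toLp 2) (Matrix.mulVec_mulVec (WithLp.ofLp z) M N).symm

lemma norm_mulVecE_le {p q : ℕ} (M : Matrix (Fin p) (Fin q) ℝ) (z : EuclideanSpace ℝ (Fin q)) :
    ‖mulVecE M z‖ ≤ frobNorm M * ‖z‖ := by
  refine le_of_sq_le_sq ?_ (mul_nonneg (frobNorm_nonneg M) (norm_nonneg z))
  rw [mul_pow, frobNorm_sq, EuclideanSpace.real_norm_sq_eq, EuclideanSpace.real_norm_sq_eq,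
    Finset.sum_mul]
  refine Finset.sum_le_sum fun i _ => ?_
  rw [mulVecE_apply]
  exact Finset.sum_mul_sq_le_sq_mul_sq _ _ _

lemma norm_mulVecE_diagonal_le {p : ℕ} {g : Fin p → ℝ} {c : ℝ} (hc : 0 ≤ c)
    (hg : ∀ i, |g i| ≤ c) (z : EuclideanSpace ℝ (Fin p)) :
    ‖mulVecE (Matrix.diagonal g) z‖ ≤ c * ‖z‖ := by
  refine le_of_sq_le_sq ?_ (mul_nonneg hc (norm_nonneg z))
  rw [mul_pow, EuclideanSpace.real_norm_sq_eq, EuclideanSpace.real_norm_sq_eq, Finset.mul_sum]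
  refine Finset.sum_le_sum fun i _ => ?_
  have : mulVecE (Matrix.diagonal g) z i = g i * z i :=
    Matrix.mulVec_diagonal g (WithLp.ofLp z) i
  rw [this, mul_pow]
  exact mul_le_mul_of_nonneg_right (sq_le_sq' (abs_le.mp (hg i)).1 (abs_le.mp (hg i)).2)
    (sq_nonneg _)

variable {n d : ℕ} (dims : ℕ → ℕ) (arr : EuclideanSpace ℝ (Fin d) →ₗ[ℝ] WeightFam n dims)
  (D : (j : ℕ) → Fin (dims j) → ℝ)

/-- The `k`-th layer (without activation beyond the fixed pattern `D`) as a linear map depending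
linearly on the parameters; it vanishes beyond the depth of the network. -/
def patLayer (k : ℕ) : EuclideanSpace ℝ (Fin d) →L[ℝ]
    EuclideanSpace ℝ (Fin (dims k)) →L[ℝ] EuclideanSpace ℝ (Fin (dims (k + 1))) :=
  if hk : k < n then
    LinearMap.toContinuousLinearMap
      (LinearMap.toContinuousLinearMap.toLinearMap ∘ₗ Matrix.toEuclideanLin.toLinearMap ∘ₗ
        mulLeftLinearMap (Fin (dims k)) ℝ (Matrix.diagonal (D (k + 1))) ∘ₗ
        LinearMap.proj (⟨k, hk⟩ : Fin n) ∘ₗ arr)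
  else 0

/-- The Frobenius norms of the weight matrices, extended by zero. -/
def layerNorm (θ : EuclideanSpace ℝ (Fin d)) (k : ℕ) : ℝ :=
  if hk : k < n then frobNorm (arr θ ⟨k, hk⟩) else 0

variable {dims}

lemma layerNorm_nonneg (θ : EuclideanSpace ℝ (Fin d)) (k : ℕ) : 0 ≤ layerNorm dims arr θ k := by
  unfold layerNorm
  split_ifs
  · exact frobNorm_nonneg _
  · exact le_rfl

lemma layerNorm_val (θ : EuclideanSpace ℝ (Fin d)) (j : Fin n) :
    layerNorm dims arr θ j = frobNorm (arr θ j) := by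
  simp [layerNorm]

variable {arr D}

lemma patLayer_apply {k : ℕ} (hk : k < n) (θ : EuclideanSpace ℝ (Fin d))
    (z : EuclideanSpace ℝ (Fin (dims k))) :
    patLayer dims arr D k θ z = mulVecE (Matrix.diagonal (D (k + 1)) * arr θ ⟨k, hk⟩) z := by
  rw [patLayer, dif_pos hk]
  rfl

lemma mulVecE_segProdD (θ : EuclideanSpace ℝ (Fin d)) (x : EuclideanSpace ℝ (Fin (dims 0)))
    {k : ℕ} (hk : k ≤ n) :
    mulVecE (segProdD dims (arr θ) D 0 k) x = layerState (patLayer dims arr D) x θ k := by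
  induction k with
  | zero =>
    have : castId (dims 0) (dims 0) = 1 := by
      ext i j
      simp [castId, Matrix.one_apply, Fin.ext_iff]
    simp [segProdD, this, mulVecE, layerState]
  | succ k ih =>
    rw [segProdD, if_neg (by omega), dif_pos (Nat.lt_of_succ_le hk), mulVecE_mul, ih (by omega),
      layerState, patLayer_apply (Nat.lt_of_succ_le hk)]

lemma norm_patLayer_le {δ : ℕ → ℝ} (hδ : ∀ k, 0 ≤ δ k)
    (hD : ∀ k < n, ∀ p, |D (k + 1) p| ≤ δ k) (θ : EuclideanSpace ℝ (Fin d)) (k : ℕ)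
    (z : EuclideanSpace ℝ (Fin (dims k))) :
    ‖patLayer dims arr D k θ z‖ ≤ δ k * (layerNorm dims arr θ k * ‖z‖) := by
  by_cases hk : k < n
  · rw [patLayer_apply hk, mulVecE_mul]
    refine (norm_mulVecE_diagonal_le (hδ k) (hD k hk) _).trans
      (mul_le_mul_of_nonneg_left ?_ (hδ k))
    rw [layerNorm, dif_pos hk]
    exact norm_mulVecE_le _ _
  · simp [patLayer, layerNorm, hk]

lemma sum_layerNorm_sq
    (hinner : ∀ u v : EuclideanSpace ℝ (Fin d), ⟪u, v⟫ =
      ∑ j : Fin n, ∑ p : Fin (dims (j.val + 1)), ∑ q : Fin (dims j.val),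
        arr u j p q * arr v j p q) (v : EuclideanSpace ℝ (Fin d)) :
    ∑ k ∈ Finset.range n, layerNorm dims arr v k ^ 2 = ‖v‖ ^ 2 := by
  rw [← real_inner_self_eq_norm_sq, hinner, Finset.sum_range]
  refine Finset.sum_congr rfl fun j _ => ?_
  rw [layerNorm_val, frobNorm_sq]
  simp only [sq]

lemma prod_layerNorm_le_sSup (θ : EuclideanSpace ℝ (Fin d)) (m : ℕ) {J : Finset ℕ}
    (hJ : J ⊆ Finset.range n) (hcard : J.card = m) :
    ∏ j ∈ J, layerNorm dims arr θ j ≤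
      sSup {r : ℝ | ∃ J : Finset (Fin n), J.card = m ∧ r = ∏ j ∈ J, frobNorm (arr θ j)} := by
  have hlt : ∀ j ∈ J, j < n := fun j hj => Finset.mem_range.mp (hJ hj)
  refine le_csSup ?_ ⟨J.attachFin hlt, by rw [Finset.card_attachFin, hcard], ?_⟩
  · refine ((Set.finite_range fun J : Finset (Fin n) =>
      ∏ j ∈ J, frobNorm (arr θ j)).subset ?_).bddAbove
    rintro _ ⟨J, -, rfl⟩
    exact ⟨J, rfl⟩
  · conv_lhs => rw [← Finset.map_valEmbedding_attachFin hlt, Finset.prod_map]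
    exact Finset.prod_congr rfl fun j _ => layerNorm_val arr θ j

end Network

/-- Lemma 5 of the paper: lower bound on the minimal eigenvalue of the
Hessian of the training loss of a fully connected network with homogeneous non-linear
activation, at a point where the loss coincides with a fixed-activation-pattern function
on an open neighborhood, expressed as a quadratic-form bound. -/
theorem relu_net_hessian_min_eig_lower_bound {n d : ℕ} (hn : 2 ≤ n) (dims : ℕ → ℕ)
    (α α' : ℝ) (hα : α ≠ α')
    {Y : Type*} (s : ℕ) (hs : 0 < s)
    (x : Fin s → EuclideanSpace ℝ (Fin (dims 0))) (y : Fin s → Y)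
    (loss : EuclideanSpace ℝ (Fin (dims n)) → Y → ℝ)
    (hconv : ∀ yy : Y, ConvexOn ℝ Set.univ (fun v => loss v yy))
    (hsm : ∀ yy : Y, ContDiff ℝ 2 (fun v => loss v yy))
    (arr : EuclideanSpace ℝ (Fin d) →ₗ[ℝ] WeightFam n dims)
    (harr : Function.Bijective arr)
    (hinner : ∀ u v : EuclideanSpace ℝ (Fin d), ⟪u, v⟫ =
      ∑ j : Fin n, ∑ p : Fin (dims (j.val + 1)), ∑ q : Fin (dims j.val),
        arr u j p q * arr v j p q)
    (D : Fin s → (j : ℕ) → Fin (dims j) → ℝ)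
    (hD : ∀ i j, 1 ≤ j → j + 1 ≤ n → ∀ p, D i j p = α ∨ D i j p = α')
    (hDtop : ∀ i p, D i n p = 1)
    (θ : EuclideanSpace ℝ (Fin d))
    (hcoin : ∃ U : Set (EuclideanSpace ℝ (Fin d)), IsOpen U ∧ θ ∈ U ∧
      ∀ θ'' ∈ U, netLossNL dims α α' loss x y arr θ'' = patLoss dims loss x y D arr θ'') :
    ∀ v : EuclideanSpace ℝ (Fin d),
      -((max |α| |α'|) ^ (n - 1) * (((n : ℝ) - 1) / (s : ℝ)) *
          (∑ i, ‖gradient (fun u => loss u (y i))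
              (mulVecE (segProdD dims (arr θ) (D i) 0 n) (x i))‖ * ‖x i‖) *
          sSup {r : ℝ | ∃ J : Finset (Fin n), J.card = n - 2 ∧
            r = ∏ j ∈ J, frobNorm (arr θ j)}) * ‖v‖ ^ 2 ≤
        hessQ (netLossNL dims α α' loss x y arr) θ v := by
  intro v
  obtain ⟨U, hU, hθU, hfU⟩ := hcoin
  have hev : netLossNL dims α α' loss x y arr =ᶠ[nhds θ] patLoss dims loss x y D arr :=
    Filter.eventually_of_mem (hU.mem_nhds hθU) hfU
  rw [hev.hessQ_eq]
  have hstate : ∀ (i : Fin s) (θ : EuclideanSpace ℝ (Fin d)),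
      mulVecE (segProdD dims (arr θ) (D i) 0 n) (x i) =
        layerState (patLayer dims arr (D i)) (x i) θ n :=
    fun i θ => mulVecE_segProdD θ (x i) le_rfl
  have hpat : patLoss dims loss x y D arr = fun θ =>
      1 / (s : ℝ) * ∑ i, loss (layerState (patLayer dims arr (D i)) (x i) θ n) (y i) := by
    funext θ
    simp only [patLoss, hstate]
  simp only [hstate]
  rw [hpat]
  refine le_trans ?_ (sum_inner_gradient_le_hessQ
    (φ := fun i u => loss u (y i))
    (P := fun i θ => layerState (patLayer dims arr (D i)) (x i) θ n)
    (fun i => hconv (y i)) (fun i => hsm (y i)) (fun i => contDiff_layerState _ _ n) θ v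
    (fun i t => hasDerivAt_layerState _ _ θ v n t)
    (fun i => hasDerivAt_layerDeriv _ _ θ v n 0))
  simp only [zero_smul, add_zero]
  set c : ℝ := max |α| |α'| with hc
  have hc₀ : 0 ≤ c := (abs_nonneg α).trans (le_max_left _ _)
  set M : ℝ := sSup {r : ℝ | ∃ J : Finset (Fin n), J.card = n - 2 ∧
    r = ∏ j ∈ J, frobNorm (arr θ j)} with hM
  have hM₀ : 0 ≤ M := by
    refine Real.sSup_nonneg ?_
    rintro _ ⟨J, -, rfl⟩
    exact Finset.prod_nonneg fun j _ => frobNorm_nonneg _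
  set δ : ℕ → ℝ := fun k => if k + 1 = n then 1 else c with hδ
  have hδ₀ : ∀ k, 0 ≤ δ k := fun k => by
    simp only [hδ]
    split_ifs
    exacts [zero_le_one, hc₀]
  have hDδ : ∀ i, ∀ k < n, ∀ p, |D i (k + 1) p| ≤ δ k := fun i k hk p => by
    simp only [hδ]
    split_ifs with h
    · subst h
      rw [hDtop, abs_one]
    · rcases hD i (k + 1) (by omega) (by omega) p with h | h <;> rw [h]
      exacts [le_max_left _ _, le_max_right _ _]
  have hprod : ∏ j ∈ Finset.range n, δ j = c ^ (n - 1) := by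
    obtain ⟨m, rfl⟩ : ∃ m, n = m + 1 := ⟨n - 1, by omega⟩
    rw [Finset.prod_range_succ, Finset.prod_congr rfl (g := fun _ => c)]
    · simp [hδ]
    · intro j hj
      have : j ≠ m := (Finset.mem_range.mp hj).ne
      simp [hδ, this]
  have htwo : 2 * replaceTwo (layerNorm dims arr θ) (layerNorm dims arr v) n ≤
      M * ((n - 1) * ‖v‖ ^ 2) := by
    rw [← sum_layerNorm_sq hinner v]
    exact two_mul_replaceTwo_le (layerNorm_nonneg arr v) hM₀
      fun J hJ hcard => prod_layerNorm_le_sSup θ (n - 2) hJ hcard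
  have hterm : ∀ i, -(c ^ (n - 1) * (M * ((n - 1) * ‖v‖ ^ 2)) *
      (‖gradient (fun u => loss u (y i)) (layerState (patLayer dims arr (D i)) (x i) θ n)‖ *
        ‖x i‖)) ≤
      ⟪gradient (fun u => loss u (y i)) (layerState (patLayer dims arr (D i)) (x i) θ n),
        layerDeriv₂ (patLayer dims arr (D i)) (x i) v θ n⟫ := fun i => by
    set g := gradient (fun u => loss u (y i)) (layerState (patLayer dims arr (D i)) (x i) θ n)
    have h₁ := neg_le_of_abs_le
      (abs_real_inner_le_norm g (layerDeriv₂ (patLayer dims arr (D i)) (x i) v θ n))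
    have h₂ := norm_layerDeriv₂_le (x := x i) hδ₀ (layerNorm_nonneg arr θ)
      (layerNorm_nonneg arr v) (norm_patLayer_le hδ₀ (hDδ i) θ) (norm_patLayer_le hδ₀ (hDδ i) v) n
    rw [hprod] at h₂
    have h₃ : ‖layerDeriv₂ (patLayer dims arr (D i)) (x i) v θ n‖ ≤
        c ^ (n - 1) * (M * ((n - 1) * ‖v‖ ^ 2)) * ‖x i‖ :=
      h₂.trans (mul_le_mul_of_nonneg_right
        (mul_le_mul_of_nonneg_left htwo (pow_nonneg hc₀ _)) (norm_nonneg _))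
    have h₄ := mul_le_mul_of_nonneg_left h₃ (norm_nonneg g)
    linarith
  have hsum := mul_le_mul_of_nonneg_left (Finset.sum_le_sum fun i (_ : i ∈ Finset.univ) => hterm i)
    (by positivity : (0 : ℝ) ≤ 1 / s)
  refine le_of_eq_of_le ?_ hsum
  rw [Finset.sum_neg_distrib, ← Finset.mul_sum]
  ring
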